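/- arXiv:0710.0222 — 2 statements merged into one kernel-verified Lean document; each statement's English description precedes it below -/
import Mathlib

section
/- Let k ∈ ℕ and δ ∉ 𝒞_k = {−p/(2(n+1)) : p = 0,…,2k−2}. Then R^k_δ is the direct sum of the subspaces R^{k,ℓ}_δ = X^ℓ(R^{k−ℓ}_δ ∩ ker i_α), ℓ = 0,…,k, each of which is an eigenspace of the Casimir operator C^k_δ = (1/(n+2))(c(k,δ)·id + X ∘ i_α) with eigenvalue ε^{k,ℓ}_δ = (1/(n+2))(c(k,δ) + r(ℓ, k−ℓ)); moreover, the eigenvalues ε^{k,ℓ}_δ corresponding to distinct ℓ ∈ {0,…,k} are pairwise distinct. -/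
open scoped BigOperators

noncomputable section

/-- Points of `ℝ^{2n+1}`. -/
abbrev Vc (n : ℕ) : Type := Fin (2*n+1) → ℝ

/-- Partial derivative of `f : ℝ^ι → ℝ` in the `i`-th coordinate direction. -/
def pd {ι : Type*} [Fintype ι] [DecidableEq ι] (i : ι) (f : (ι → ℝ) → ℝ) (x : ι → ℝ) : ℝ :=
  fderiv ℝ f x (Pi.single i 1)

/-- Index of the coordinate `p_i` in `ℝ^{2n+1}`. -/
def pIdx (n : ℕ) (i : Fin n) : Fin (2*n+1) := ⟨i.1, by have := i.isLt; omega⟩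
/-- Index of the coordinate `q^i` in `ℝ^{2n+1}`. -/
def qIdx (n : ℕ) (i : Fin n) : Fin (2*n+1) := ⟨n + i.1, by have := i.isLt; omega⟩
/-- Index of the coordinate `t` in `ℝ^{2n+1}`. -/
def tIdx (n : ℕ) : Fin (2*n+1) := ⟨2*n, by omega⟩

/-- The contact Hamiltonian vector field `X_h` of a function `h` on `ℝ^{2n+1}`. -/
def contactHam (n : ℕ) (h : Vc n → ℝ) (x : Vc n) : Vc n :=
  fun a =>
    if ha : a.1 < n then
      -pd (qIdx n ⟨a.1, ha⟩) h x - pd (tIdx n) h x * x a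
    else if ha' : a.1 < 2*n then
      pd (pIdx n ⟨a.1 - n, by omega⟩) h x - pd (tIdx n) h x * x a
    else
      (∑ k : Fin n, (x (pIdx n k) * pd (pIdx n k) h x + x (qIdx n k) * pd (qIdx n k) h x))
        - 2 * h x

/-- Base partial derivative `∂_i S` of a symbol `S(x;ξ)`. -/
def pdB (n : ℕ) (i : Fin (2*n+1)) (S : Vc n → Vc n → ℝ) (x ξ : Vc n) : ℝ :=
  fderiv ℝ (fun y => S y ξ) x (Pi.single i 1)

/-- Fiber partial derivative `∂_{ξ_i} S` of a symbol `S(x;ξ)`. -/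
def pdF (n : ℕ) (i : Fin (2*n+1)) (S : Vc n → Vc n → ℝ) (x ξ : Vc n) : ℝ :=
  fderiv ℝ (fun ζ => S x ζ) ξ (Pi.single i 1)

/-- `S` belongs to `R^k_δ`: a smooth map from `ℝ^{2n+1}` into homogeneous polynomials of
degree `k` in the fiber variables `ξ` (the density weight `δ + k/(n+1)` is recorded
through the actions and operators below). -/
def InR (n k : ℕ) (S : Vc n → Vc n → ℝ) : Prop :=
  ContDiff ℝ (⊤ : ℕ∞) (fun p : Vc n × Vc n => S p.1 p.2) ∧
  ∀ (x : Vc n) (c : ℝ) (ξ : Vc n), S x (c • ξ) = c ^ k * S x ξ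

/-- The vertical cotangent lift of the contact form:
`i_α = (1/2)(Σ_j (p_j ∂_{ξ_{q^j}} − q^j ∂_{ξ_{p_j}}) − ∂_{ξ_t})`. -/
def iAlpha (n : ℕ) (S : Vc n → Vc n → ℝ) (x ξ : Vc n) : ℝ :=
  (1/2) * ((∑ j : Fin n, (x (pIdx n j) * pdF n (qIdx n j) S x ξ
      - x (qIdx n j) * pdF n (pIdx n j) S x ξ)) - pdF n (tIdx n) S x ξ)

/-- The generalized contact Hamiltonian with weight constant `a` (equal to
`2(n+1)δ + k` on `R^k_δ`):
`X(S) = Σ_j (ξ_{q^j}∂_{p_j}S − ξ_{p_j}∂_{q^j}S) + ξ_t ℰ_s S − ⟨ℰ_s,ξ_s⟩∂_t S + a ξ_t S`. -/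
def genHam (n : ℕ) (a : ℝ) (S : Vc n → Vc n → ℝ) (x ξ : Vc n) : ℝ :=
  (∑ j : Fin n, (ξ (qIdx n j) * pdB n (pIdx n j) S x ξ
      - ξ (pIdx n j) * pdB n (qIdx n j) S x ξ))
  + ξ (tIdx n) * (∑ j : Fin n, (x (pIdx n j) * pdB n (pIdx n j) S x ξ
      + x (qIdx n j) * pdB n (qIdx n j) S x ξ))
  - (∑ j : Fin n, (x (pIdx n j) * ξ (pIdx n j) + x (qIdx n j) * ξ (qIdx n j)))
      * pdB n (tIdx n) S x ξ
  + a * ξ (tIdx n) * S x ξ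

/-- `ℓ`-fold iteration `X^ℓ` of the generalized Hamiltonian, starting with weight
constant `a` and increasing it by `1` at each step. -/
def genHamPow (n : ℕ) (a : ℝ) : ℕ → (Vc n → Vc n → ℝ) → (Vc n → Vc n → ℝ)
  | 0, S => S
  | ℓ+1, S => genHam n (a + ℓ) (genHamPow n a ℓ S)

/-- The action of a vector field `Xf` on `R^k_δ` with weight `w = δ + k/(n+1)`:
`L_{X}S = X(S) − Σ_{i,j}∂_jX^i ξ_i ∂_{ξ_j}S + w (div X) S`. -/
def LAct (n : ℕ) (w : ℝ) (Xf : Vc n → Vc n) (S : Vc n → Vc n → ℝ) (x ξ : Vc n) : ℝ :=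
  (∑ i, Xf x i * pdB n i S x ξ)
  - (∑ i, ∑ j, pd j (fun y => Xf y i) x * ξ i * pdF n j S x ξ)
  + w * (∑ i, pd i (fun y => Xf y i) x) * S x ξ

/-- Contact Hamiltonians of the generators of `sp_{2n+2}`: the functions
`1, p_i, q^i, t, p_ip_j, q^iq^j, p_jq^i, tp_i, tq^i, t²`. -/
def IsGen (n : ℕ) (h : Vc n → ℝ) : Prop :=
  h = (fun _ => 1) ∨
  (∃ i, h = fun x => x (pIdx n i)) ∨
  (∃ i, h = fun x => x (qIdx n i)) ∨
  h = (fun x => x (tIdx n)) ∨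
  (∃ i j, h = fun x => x (pIdx n i) * x (pIdx n j)) ∨
  (∃ i j, h = fun x => x (qIdx n i) * x (qIdx n j)) ∨
  (∃ i j, h = fun x => x (pIdx n j) * x (qIdx n i)) ∨
  (∃ i, h = fun x => x (tIdx n) * x (pIdx n i)) ∨
  (∃ i, h = fun x => x (tIdx n) * x (qIdx n i)) ∨
  h = (fun x => x (tIdx n) * x (tIdx n))

/-- The subspace `R^{k,ℓ}_δ = X^ℓ(R^{k−ℓ}_δ ∩ ker i_α)` of `R^k_δ`. -/
def Rsub (n : ℕ) (δ : ℝ) (k ℓ : ℕ) : Set (Vc n → Vc n → ℝ) :=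
  {T | ∃ S, InR n (k - ℓ) S ∧ (∀ x ξ, iAlpha n S x ξ = 0) ∧
    T = genHamPow n (2*((n : ℝ)+1)*δ + ((k - ℓ : ℕ) : ℝ)) ℓ S}

/-- `c(k,δ) = (n+1)²δ² − (n+1)²δ + k(n+1)δ + (k²−k)/2`. -/
def cConst (n k : ℕ) (δ : ℝ) : ℝ :=
  ((n:ℝ)+1)^2*δ^2 - ((n:ℝ)+1)^2*δ + (k:ℝ)*((n:ℝ)+1)*δ + ((k:ℝ)^2 - (k:ℝ))/2

/-- `r(ℓ,m) = −(ℓ/2)(2(n+1)δ + 2m + ℓ − 1)`. -/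
def rConst (n : ℕ) (δ : ℝ) (ℓ m : ℕ) : ℝ :=
  -((ℓ:ℝ)/2) * (2*((n:ℝ)+1)*δ + 2*(m:ℝ) + (ℓ:ℝ) - 1)

/-- The Casimir eigenvalue `ε^{k,ℓ}_δ = (1/(n+2))(c(k,δ) + r(ℓ,k−ℓ))`. -/
def epsVal (n k : ℕ) (δ : ℝ) (ℓ : ℕ) : ℝ :=
  (1/((n:ℝ)+2)) * (cConst n k δ + rConst n δ ℓ (k - ℓ))

/-- The Casimir operator `C^k_δ = (1/(n+2))(c(k,δ) id + X ∘ i_α)` on `R^k_δ`. -/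
def casOp (n k : ℕ) (δ : ℝ) (T : Vc n → Vc n → ℝ) (x ξ : Vc n) : ℝ :=
  (1/((n:ℝ)+2)) * (cConst n k δ * T x ξ
    + genHam n (2*((n:ℝ)+1)*δ + ((k:ℝ) - 1)) (iAlpha n T) x ξ)

open scoped BigOperators ContDiff

/-- Joint smoothness of a symbol. -/
def SmoothSymbol (n : ℕ) (S : Vc n → Vc n → ℝ) : Prop :=
  ContDiff ℝ (⊤ : ℕ∞) (fun p : Vc n × Vc n => S p.1 p.2)

/-- The fiber component of the vertical field defining `2 i_α`. -/
def vertVec (n : ℕ) (x : Vc n) : Vc n :=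
  (∑ j : Fin n, (x (pIdx n j) • (Pi.single (qIdx n j) 1 : Vc n)
    - x (qIdx n j) • (Pi.single (pIdx n j) 1 : Vc n))) - Pi.single (tIdx n) 1

/-- The base component of the horizontal field which is the principal part of `genHam`. -/
def horVec (n : ℕ) (x ξ : Vc n) : Vc n :=
  (∑ j : Fin n, ((ξ (qIdx n j) + ξ (tIdx n) * x (pIdx n j)) • (Pi.single (pIdx n j) 1 : Vc n)
    + (ξ (tIdx n) * x (qIdx n j) - ξ (pIdx n j)) • (Pi.single (qIdx n j) 1 : Vc n)))
  - (∑ j : Fin n, (x (pIdx n j) * ξ (pIdx n j) + x (qIdx n j) * ξ (qIdx n j))) •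
    (Pi.single (tIdx n) 1 : Vc n)

/-- The vertical vector field of `2 i_α` on the cotangent space. -/
def vertField (n : ℕ) (z : Vc n × Vc n) : Vc n × Vc n := (0, vertVec n z.1)

/-- The horizontal vector field of `genHam` on the cotangent space. -/
def horField (n : ℕ) (z : Vc n × Vc n) : Vc n × Vc n := (horVec n z.1 z.2, 0)

section Indices

variable {n : ℕ}

lemma idx_cases (i : Fin (2*n+1)) :
    (∃ j, i = pIdx n j) ∨ (∃ j, i = qIdx n j) ∨ i = tIdx n := by
  rcases lt_or_ge i.1 n with h | h
  · exact .inl ⟨⟨i.1, h⟩, rfl⟩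
  · rcases lt_or_ge i.1 (2*n) with h' | h'
    · exact .inr (.inl ⟨⟨i.1 - n, by omega⟩, by ext; simp [qIdx]; omega⟩)
    · exact .inr (.inr (by ext; simp [tIdx]; omega))

@[simp] lemma pIdx_inj (i j : Fin n) : pIdx n i = pIdx n j ↔ i = j := by
  simp [pIdx, Fin.ext_iff]

@[simp] lemma qIdx_inj (i j : Fin n) : qIdx n i = qIdx n j ↔ i = j := by
  simp [qIdx, Fin.ext_iff]

@[simp] lemma pIdx_ne_qIdx (i j : Fin n) : pIdx n i ≠ qIdx n j := by
  simp [pIdx, qIdx]; omega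

@[simp] lemma qIdx_ne_pIdx (i j : Fin n) : qIdx n i ≠ pIdx n j :=
  (pIdx_ne_qIdx j i).symm

@[simp] lemma pIdx_ne_tIdx (i : Fin n) : pIdx n i ≠ tIdx n := by
  simp [pIdx, tIdx]; omega

@[simp] lemma qIdx_ne_tIdx (i : Fin n) : qIdx n i ≠ tIdx n := by
  simp [qIdx, tIdx]; omega

@[simp] lemma tIdx_ne_pIdx (i : Fin n) : tIdx n ≠ pIdx n i := (pIdx_ne_tIdx i).symm

@[simp] lemma tIdx_ne_qIdx (i : Fin n) : tIdx n ≠ qIdx n i := (qIdx_ne_tIdx i).symm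

@[simp] lemma vertVec_p (x : Vc n) (j : Fin n) : vertVec n x (pIdx n j) = -x (qIdx n j) := by
  simp [vertVec, Finset.sum_apply, Pi.single_apply]

@[simp] lemma vertVec_q (x : Vc n) (j : Fin n) : vertVec n x (qIdx n j) = x (pIdx n j) := by
  simp [vertVec, Finset.sum_apply, Pi.single_apply]

@[simp] lemma vertVec_t (x : Vc n) : vertVec n x (tIdx n) = -1 := by
  simp [vertVec, Finset.sum_apply]

@[simp] lemma horVec_p (x ξ : Vc n) (j : Fin n) :
    horVec n x ξ (pIdx n j) = ξ (qIdx n j) + ξ (tIdx n) * x (pIdx n j) := by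
  simp [horVec, Finset.sum_apply, Pi.single_apply]

@[simp] lemma horVec_q (x ξ : Vc n) (j : Fin n) :
    horVec n x ξ (qIdx n j) = ξ (tIdx n) * x (qIdx n j) - ξ (pIdx n j) := by
  simp [horVec, Finset.sum_apply, Pi.single_apply]

@[simp] lemma horVec_t (x ξ : Vc n) :
    horVec n x ξ (tIdx n) =
      -∑ j : Fin n, (x (pIdx n j) * ξ (pIdx n j) + x (qIdx n j) * ξ (qIdx n j)) := by
  simp [horVec, Finset.sum_apply]

lemma vec_ext {v w : Vc n} (hp : ∀ j, v (pIdx n j) = w (pIdx n j))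
    (hq : ∀ j, v (qIdx n j) = w (qIdx n j)) (ht : v (tIdx n) = w (tIdx n)) : v = w := by
  funext i
  rcases idx_cases i with ⟨j, rfl⟩ | ⟨j, rfl⟩ | rfl
  exacts [hp j, hq j, ht]

lemma horVec_add_smul_vertVec (x ξ : Vc n) (s : ℝ) :
    horVec n x (ξ + s • vertVec n x) = horVec n x ξ := by
  apply vec_ext
  · intro j; simp; ring
  · intro j; simp; ring
  · simp only [horVec_t, Pi.add_apply, Pi.smul_apply, vertVec_p, vertVec_q, smul_eq_mul]
    congr 1
    exact Finset.sum_congr rfl fun j _ => by ring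

lemma vertVec_add_smul_horVec (x ξ : Vc n) (s : ℝ) :
    vertVec n (x + s • horVec n x ξ) = vertVec n x + s • (ξ + ξ (tIdx n) • vertVec n x) := by
  apply vec_ext
  · intro j; simp; ring
  · intro j; simp; ring
  · simp

lemma horVec_smul (x ξ : Vc n) (c : ℝ) : horVec n x (c • ξ) = c • horVec n x ξ := by
  apply vec_ext
  · intro j; simp; ring
  · intro j; simp; ring
  · simp only [horVec_t, Pi.smul_apply, smul_eq_mul, mul_neg, Finset.mul_sum]
    congr 1
    exact Finset.sum_congr rfl fun j _ => by ring

end Indices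

section Fields

variable (n : ℕ)

lemma contDiff_vertField : ContDiff ℝ ∞ (vertField n) := by
  unfold vertField vertVec
  fun_prop

lemma contDiff_horField : ContDiff ℝ ∞ (horField n) := by
  unfold horField horVec
  fun_prop

lemma fderiv_horField_vertField (z : Vc n × Vc n) :
    fderiv ℝ (horField n) z (vertField n z) = 0 := by
  rw [← ((contDiff_horField n).differentiable (by simp) z).lineDeriv_eq_fderiv, lineDeriv]
  simp [horField, vertField, horVec_add_smul_vertVec]

lemma fderiv_vertField_horField (z : Vc n × Vc n) :
    fderiv ℝ (vertField n) z (horField n z) =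
      (0, z.2) + z.2 (tIdx n) • vertField n z := by
  rw [← ((contDiff_vertField n).differentiable (by simp) z).lineDeriv_eq_fderiv, lineDeriv]
  have h : (fun s : ℝ => vertField n (z + s • horField n z)) =
      fun s : ℝ => vertField n z + s • ((0, z.2) + z.2 (tIdx n) • vertField n z) := by
    funext s
    simp [horField, vertField, vertVec_add_smul_horVec]
  rw [h]
  have := ((hasDerivAt_id (0 : ℝ)).smul_const
    (((0, z.2) : Vc n × Vc n) + z.2 (tIdx n) • vertField n z)).const_add (vertField n z)
  simpa using this.deriv

end Fields

section Operators

variable {n k : ℕ} {S T : Vc n → Vc n → ℝ}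

lemma InR.smooth (h : InR n k S) : SmoothSymbol n S := h.1

lemma pdB_eq (hS : SmoothSymbol n S) (i : Fin (2*n+1)) (x ξ : Vc n) :
    pdB n i S x ξ =
      fderiv ℝ (fun p : Vc n × Vc n => S p.1 p.2) (x, ξ) (Pi.single i 1, 0) := by
  have h := ((hS.differentiable (by simp) (x, ξ)).hasFDerivAt).comp x
    (hasFDerivAt_prodMk_left (𝕜 := ℝ) x ξ)
  have h' := h.fderiv
  simp only [Function.comp_def] at h'
  rw [pdB, h']
  simp

lemma pdF_eq (hS : SmoothSymbol n S) (i : Fin (2*n+1)) (x ξ : Vc n) :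
    pdF n i S x ξ =
      fderiv ℝ (fun p : Vc n × Vc n => S p.1 p.2) (x, ξ) (0, Pi.single i 1) := by
  have h := ((hS.differentiable (by simp) (x, ξ)).hasFDerivAt).comp ξ
    (hasFDerivAt_prodMk_right (𝕜 := ℝ) x ξ)
  have h' := h.fderiv
  simp only [Function.comp_def] at h'
  rw [pdF, h']
  simp

lemma iAlpha_eq (hS : SmoothSymbol n S) (x ξ : Vc n) :
    iAlpha n S x ξ =
      (1/2) * fderiv ℝ (fun p : Vc n × Vc n => S p.1 p.2) (x, ξ) (vertField n (x, ξ)) := by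
  set L := fderiv ℝ (fun p : Vc n × Vc n => S p.1 p.2) (x, ξ) with hL
  have h : ∀ v, L (0, v) = L.comp (ContinuousLinearMap.inr ℝ (Vc n) (Vc n)) v := by simp
  simp only [iAlpha, pdF_eq hS, ← hL, vertField, vertVec, h, map_sub, map_sum, map_smul,
    smul_eq_mul]

lemma genHam_eq (hS : SmoothSymbol n S) (a : ℝ) (x ξ : Vc n) :
    genHam n a S x ξ =
      fderiv ℝ (fun p : Vc n × Vc n => S p.1 p.2) (x, ξ) (horField n (x, ξ))
        + a * ξ (tIdx n) * S x ξ := by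
  set L := fderiv ℝ (fun p : Vc n × Vc n => S p.1 p.2) (x, ξ) with hL
  have h : ∀ v, L (v, 0) = L.comp (ContinuousLinearMap.inl ℝ (Vc n) (Vc n)) v := by simp
  simp only [genHam, pdB_eq hS, ← hL, horField, horVec, h, map_sub, map_sum, map_smul, map_add,
    smul_eq_mul, Finset.mul_sum, ← Finset.sum_add_distrib]
  congr 2
  exact Finset.sum_congr rfl fun j _ => by ring

lemma SmoothSymbol.iAlpha (hS : SmoothSymbol n S) : SmoothSymbol n (iAlpha n S) := by
  have : (fun p : Vc n × Vc n => _root_.iAlpha n S p.1 p.2) = fun p =>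
      (1/2) * fderiv ℝ (fun p : Vc n × Vc n => S p.1 p.2) p (vertField n p) :=
    funext fun p => iAlpha_eq hS p.1 p.2
  rw [SmoothSymbol, this]
  exact contDiff_const.mul ((hS.fderiv_right (m := ∞) le_rfl).clm_apply (contDiff_vertField n))

lemma SmoothSymbol.genHam (hS : SmoothSymbol n S) (a : ℝ) :
    SmoothSymbol n (genHam n a S) := by
  have : (fun p : Vc n × Vc n => _root_.genHam n a S p.1 p.2) = fun p =>
      fderiv ℝ (fun p : Vc n × Vc n => S p.1 p.2) p (horField n p)
        + a * p.2 (tIdx n) * S p.1 p.2 :=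
    funext fun p => genHam_eq hS a p.1 p.2
  rw [SmoothSymbol, this]
  have h2 : ContDiff ℝ ∞ (fun p : Vc n × Vc n => a * p.2 (tIdx n)) := by fun_prop
  exact ((hS.fderiv_right (m := ∞) le_rfl).clm_apply (contDiff_horField n)).add (h2.mul hS)

lemma InR.fderiv_euler (hS : InR n k S) (x ξ : Vc n) :
    fderiv ℝ (fun p : Vc n × Vc n => S p.1 p.2) (x, ξ) (0, ξ) = k * S x ξ := by
  rw [← (hS.1.differentiable (by simp) (x, ξ)).lineDeriv_eq_fderiv, lineDeriv]
  have h : (fun s : ℝ => S ((x, ξ) + s • ((0, ξ) : Vc n × Vc n)).1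
      ((x, ξ) + s • ((0, ξ) : Vc n × Vc n)).2) = fun s : ℝ => (1 + s) ^ k * S x ξ := by
    funext s
    rw [← hS.2 x (1 + s) ξ]
    simp [add_smul]
  rw [h]
  have := ((((hasDerivAt_id (0 : ℝ)).const_add 1).pow k).mul_const (S x ξ)).deriv
  simpa using this

/-- The commutation relation of `i_α` with `X` on symbols of degree `k`. -/
lemma InR.iAlpha_genHam (hS : InR n k S) (a : ℝ) :
    iAlpha n (genHam n a S) = genHam n (a - 1) (iAlpha n S) - ((a + k) / 2) • S := by
  funext x ξ
  have hs := hS.smooth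
  set F : Vc n × Vc n → ℝ := fun p => S p.1 p.2 with hF
  have hF' : ContDiff ℝ ∞ (fderiv ℝ F) := ContDiff.fderiv_right hs (m := ∞) le_rfl
  have hV := contDiff_vertField n
  have hW := contDiff_horField n
  have hbr := VectorField.fderiv_apply_lieBracket (𝕜 := ℝ) (V := vertField n) (W := horField n)
    (f := F) (x := (x, ξ)) (n := ∞) hs.contDiffAt (by simp; norm_cast)
    (hW.differentiable (by simp) _) (hV.differentiable (by simp) _)
  rw [VectorField.lieBracket_eq] at hbr
  simp only [fderiv_horField_vertField, fderiv_vertField_horField, zero_sub, map_neg, map_add,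
    map_smul, smul_eq_mul] at hbr
  rw [hF, hS.fderiv_euler, ← hF] at hbr
  have hXS : (fun p : Vc n × Vc n => genHam n a S p.1 p.2) =
      fun p => fderiv ℝ F p (horField n p) + a * (p.2 (tIdx n) * F p) :=
    funext fun p => by rw [genHam_eq hs, mul_assoc]
  have ht : HasFDerivAt (fun p : Vc n × Vc n => p.2 (tIdx n))
      ((ContinuousLinearMap.proj (tIdx n)).comp (ContinuousLinearMap.snd ℝ (Vc n) (Vc n)))
      (x, ξ) := ((ContinuousLinearMap.proj (tIdx n)).comp
        (ContinuousLinearMap.snd ℝ (Vc n) (Vc n))).hasFDerivAt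
  have hd : HasFDerivAt F (fderiv ℝ F (x, ξ)) (x, ξ) :=
    (hs.differentiable (by simp) (x, ξ)).hasFDerivAt
  have hdW : HasFDerivAt (fun p => fderiv ℝ F p (horField n p)) _ (x, ξ) :=
    ((hF'.clm_apply hW).differentiable (by simp) (x, ξ)).hasFDerivAt
  have hdV : HasFDerivAt (fun p => fderiv ℝ F p (vertField n p)) _ (x, ξ) :=
    ((hF'.clm_apply hV).differentiable (by simp) (x, ξ)).hasFDerivAt
  have hdX := (hdW.fun_add ((ht.fun_mul hd).const_mul a)).fderiv
  rw [iAlpha_eq (hs.genHam a), hXS, hdX]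
  simp only [Pi.sub_apply, Pi.smul_apply, genHam_eq hs.iAlpha, (hdV.const_mul (1/2)).fderiv,
    iAlpha_eq hs, ← hF]
  simp [vertField, hF] at hbr ⊢
  linarith

lemma SmoothSymbol.zero : SmoothSymbol n 0 := contDiff_const

lemma SmoothSymbol.add (hS : SmoothSymbol n S) (hT : SmoothSymbol n T) :
    SmoothSymbol n (S + T) := ContDiff.add hS hT

lemma SmoothSymbol.const_smul (c : ℝ) (hS : SmoothSymbol n S) : SmoothSymbol n (c • S) :=
  ContDiff.const_smul c hS

lemma iAlpha_add (hS : SmoothSymbol n S) (hT : SmoothSymbol n T) :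
    iAlpha n (S + T) = iAlpha n S + iAlpha n T := by
  funext x ξ
  have := fderiv_fun_add (hS.differentiable (by simp) (x, ξ)) (hT.differentiable (by simp) (x, ξ))
  simp [iAlpha_eq, hS, hT, hS.add hT, this, mul_add]

lemma iAlpha_smul (c : ℝ) (hS : SmoothSymbol n S) : iAlpha n (c • S) = c • iAlpha n S := by
  funext x ξ
  have := fderiv_const_mul (hS.differentiable (by simp) (x, ξ)) c
  simp [iAlpha_eq, hS, hS.const_smul, this]
  ring

lemma genHam_add (a : ℝ) (hS : SmoothSymbol n S) (hT : SmoothSymbol n T) :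
    genHam n a (S + T) = genHam n a S + genHam n a T := by
  funext x ξ
  have := fderiv_fun_add (hS.differentiable (by simp) (x, ξ)) (hT.differentiable (by simp) (x, ξ))
  simp [genHam_eq, hS, hT, hS.add hT, this]
  ring

lemma genHam_smul (a c : ℝ) (hS : SmoothSymbol n S) :
    genHam n a (c • S) = c • genHam n a S := by
  funext x ξ
  have := fderiv_const_mul (hS.differentiable (by simp) (x, ξ)) c
  simp [genHam_eq, hS, hS.const_smul, this]
  ring

lemma genHam_zero (a : ℝ) : genHam n a 0 = 0 := by
  simpa using genHam_smul (n := n) a 0 SmoothSymbol.zero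

lemma iAlpha_zero : iAlpha n 0 = 0 := by
  simpa using iAlpha_smul (n := n) 0 SmoothSymbol.zero

variable (n k) in
/-- The space of symbols of degree `k`, as a submodule. -/
def symbolModule : Submodule ℝ (Vc n → Vc n → ℝ) where
  carrier := {S | InR n k S}
  add_mem' {S T} hS hT :=
    ⟨hS.smooth.add hT.smooth, fun x c ξ => by simp [hS.2 x c ξ, hT.2 x c ξ, mul_add]⟩
  zero_mem' := ⟨SmoothSymbol.zero, by simp⟩
  smul_mem' a S hS := ⟨hS.smooth.const_smul a, fun x c ξ => by
    simp only [Pi.smul_apply, smul_eq_mul, hS.2 x c ξ]; ring⟩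

lemma InR.genHam (hS : InR n k S) (a : ℝ) : InR n (k + 1) (genHam n a S) := by
  refine ⟨hS.smooth.genHam a, fun x c ξ => ?_⟩
  have h (i) : pdB n i S x (c • ξ) = c ^ k * pdB n i S x ξ := by
    have hd : DifferentiableAt ℝ (fun y => S y ξ) x :=
      (hS.1.differentiable (by simp) (x, ξ)).fun_comp' x
        (hasFDerivAt_prodMk_left (𝕜 := ℝ) x ξ).differentiableAt
    simp only [pdB, hS.2, fderiv_const_mul hd]
    simp
  simp only [_root_.genHam, h, hS.2 x c ξ, Pi.smul_apply, smul_eq_mul, mul_add, mul_sub,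
    Finset.mul_sum, Finset.sum_mul]
  congr 1
  · congr 1
    · congr 1 <;> exact Finset.sum_congr rfl fun j _ => by ring
    · exact Finset.sum_congr rfl fun j _ => by ring
  · ring

lemma InR.pdF_smul (hS : InR n (k + 1) S) (i : Fin (2*n+1)) (x : Vc n) (c : ℝ) (ξ : Vc n) :
    pdF n i S x (c • ξ) = c ^ k * pdF n i S x ξ := by
  have hc : Continuous fun c : ℝ => pdF n i S x (c • ξ) := by
    simp only [pdF_eq hS.smooth]
    have := (ContDiff.fderiv_right hS.1 (m := ∞) le_rfl).continuous
    fun_prop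
  have hc' : Continuous fun c : ℝ => c ^ k * pdF n i S x ξ := by fun_prop
  refine congrFun (Continuous.ext_on (dense_compl_singleton (0 : ℝ)) hc hc' fun c hc0 => ?_) c
  have hd : DifferentiableAt ℝ (fun ζ => S x ζ) ξ :=
    (hS.1.differentiable (by simp) (x, ξ)).comp ξ
      (hasFDerivAt_prodMk_right (𝕜 := ℝ) x ξ).differentiableAt
  have h := fderiv_comp_smul (𝕜 := ℝ) (f := fun ζ => S x ζ) (x := ξ) c
  simp only [hS.2, fderiv_const_mul hd] at h
  have h' := congrArg (fun L => L (Pi.single i 1)) h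
  simp only [_root_.smul_apply, smul_eq_mul] at h'
  refine mul_left_cancel₀ (show c ≠ 0 from hc0) ?_
  simp only [pdF]
  rw [← h']
  ring

lemma InR.iAlpha (hS : InR n (k + 1) S) : InR n k (iAlpha n S) := by
  refine ⟨hS.smooth.iAlpha, fun x c ξ => ?_⟩
  simp only [_root_.iAlpha, hS.pdF_smul, mul_sub, Finset.mul_sum]
  congr 1
  · exact Finset.sum_congr rfl fun j _ => by ring
  · ring

lemma InR.iAlpha_eq_zero (hS : InR n 0 S) : _root_.iAlpha n S = 0 := by
  have h : ∀ x ξ, S x ξ = S x 0 := fun x ξ => by simpa using (hS.2 x 0 ξ).symm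
  funext x ξ
  simp [_root_.iAlpha, pdF, h]

end Operators

section Decomposition

variable {n k ℓ : ℕ} {δ : ℝ} {S T : Vc n → Vc n → ℝ}

lemma mem_Rsub_zero : T ∈ Rsub n δ k 0 ↔ InR n k T ∧ iAlpha n T = 0 := by
  constructor
  · rintro ⟨S, hS, h0, rfl⟩
    exact ⟨hS, funext₂ h0⟩
  · rintro ⟨hT, h0⟩
    exact ⟨T, hT, fun x ξ => by simp [h0], rfl⟩

lemma mem_Rsub_succ (hℓ : ℓ ≤ k) : T ∈ Rsub n δ (k + 1) (ℓ + 1) ↔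
    ∃ S ∈ Rsub n δ k ℓ, T = genHam n (2*((n : ℝ)+1)*δ + k) S := by
  have h : 2*((n : ℝ)+1)*δ + ((k - ℓ : ℕ) : ℝ) + ℓ = 2*((n : ℝ)+1)*δ + k := by
    push_cast [hℓ]; ring
  simp only [Rsub, Set.mem_ofPred_eq, Nat.add_sub_add_right, genHamPow, h]
  constructor
  · rintro ⟨S, hS, h0, rfl⟩
    exact ⟨_, ⟨S, hS, h0, rfl⟩, rfl⟩
  · rintro ⟨_, ⟨S, hS, h0, rfl⟩, rfl⟩
    exact ⟨S, hS, h0, rfl⟩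

lemma InR_of_mem_Rsub (hℓ : ℓ ≤ k) (hT : T ∈ Rsub n δ k ℓ) : InR n k T := by
  induction ℓ generalizing k T with
  | zero => exact (mem_Rsub_zero.1 hT).1
  | succ ℓ ih =>
    obtain ⟨k, rfl⟩ : ∃ m, k = m + 1 := ⟨k - 1, by omega⟩
    obtain ⟨S, hS, rfl⟩ := (mem_Rsub_succ (by omega)).1 hT
    exact (ih (by omega) hS).genHam _

lemma smul_mem_Rsub (c : ℝ) (hℓ : ℓ ≤ k) (hT : T ∈ Rsub n δ k ℓ) : c • T ∈ Rsub n δ k ℓ := by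
  induction ℓ generalizing k T with
  | zero =>
    obtain ⟨h, h0⟩ := mem_Rsub_zero.1 hT
    exact mem_Rsub_zero.2 ⟨(symbolModule n k).smul_mem c h, by simp [iAlpha_smul c h.smooth, h0]⟩
  | succ ℓ ih =>
    obtain ⟨k, rfl⟩ : ∃ m, k = m + 1 := ⟨k - 1, by omega⟩
    obtain ⟨S, hS, rfl⟩ := (mem_Rsub_succ (by omega)).1 hT
    exact (mem_Rsub_succ (by omega)).2 ⟨c • S, ih (by omega) hS,
      (genHam_smul _ c (InR_of_mem_Rsub (by omega) hS).smooth).symm⟩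

lemma rConst_succ (hℓ : ℓ ≤ k) : rConst n δ (ℓ + 1) (k - ℓ) =
    rConst n δ ℓ (k - ℓ) - (2*((n : ℝ)+1)*δ + k + k) / 2 := by
  simp only [rConst]
  push_cast [hℓ]
  ring

/-- `X ∘ i_α` acts on `R^{k,ℓ}_δ` by the scalar `r(ℓ, k − ℓ)`. -/
lemma genHam_iAlpha_of_mem_Rsub (hℓ : ℓ ≤ k) (hT : T ∈ Rsub n δ k ℓ) :
    genHam n (2*((n : ℝ)+1)*δ + ((k : ℝ) - 1)) (iAlpha n T) = rConst n δ ℓ (k - ℓ) • T := by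
  induction ℓ generalizing k T with
  | zero => simp [(mem_Rsub_zero.1 hT).2, genHam_zero, rConst]
  | succ ℓ ih =>
    obtain ⟨k, rfl⟩ : ∃ m, k = m + 1 := ⟨k - 1, by omega⟩
    obtain ⟨S, hS, rfl⟩ := (mem_Rsub_succ (by omega)).1 hT
    have hS' := InR_of_mem_Rsub (by omega) hS
    rw [hS'.iAlpha_genHam, add_sub_assoc, ih (by omega) hS, ← sub_smul,
      Nat.add_sub_add_right, ← rConst_succ (by omega), genHam_smul _ _ hS'.smooth]
    push_cast
    ring_nf

lemma iAlpha_genHam_of_mem_Rsub (hℓ : ℓ ≤ k) (hT : T ∈ Rsub n δ k ℓ) :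
    iAlpha n (genHam n (2*((n : ℝ)+1)*δ + k) T) = rConst n δ (ℓ + 1) (k - ℓ) • T := by
  rw [(InR_of_mem_Rsub hℓ hT).iAlpha_genHam, add_sub_assoc, genHam_iAlpha_of_mem_Rsub hℓ hT,
    ← sub_smul, rConst_succ hℓ]

lemma iAlpha_sum {ι : Type*} (s : Finset ι) (f : ι → Vc n → Vc n → ℝ)
    (hf : ∀ i ∈ s, InR n k (f i)) : iAlpha n (∑ i ∈ s, f i) = ∑ i ∈ s, iAlpha n (f i) := by
  classical
  induction s using Finset.induction_on with
  | empty => simp [iAlpha_zero]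
  | insert i s hi ih =>
    have h := fun j hj => hf j (Finset.mem_insert_of_mem hj)
    rw [Finset.sum_insert hi, Finset.sum_insert hi, iAlpha_add (hf i (by simp)).smooth
      (InR.smooth (k := k) ((symbolModule n k).sum_mem h)), ih h]

/-- The shifted weight `2(n+1)δ` avoids the integers attached to the critical set `𝒞_k`. -/
lemma weight_add_ne_zero
    (hδ : ∀ p : ℕ, (p : ℤ) ≤ 2*(k : ℤ) - 2 → δ ≠ -(p : ℝ)/(2*((n : ℝ)+1)))
    (p : ℕ) (hp : (p : ℤ) ≤ 2*(k : ℤ) - 2) : 2*((n : ℝ)+1)*δ + p ≠ 0 := by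
  intro h
  refine hδ p hp ?_
  have : (2*((n : ℝ)+1)) ≠ 0 := by positivity
  rw [eq_div_iff this]
  linarith

lemma exists_decomposition
    (hδ : ∀ p : ℕ, (p : ℤ) ≤ 2*(k : ℤ) - 2 → δ ≠ -(p : ℝ)/(2*((n : ℝ)+1)))
    (hS : InR n k S) : ∃ f : ℕ → (Vc n → Vc n → ℝ),
      (∀ ℓ ≤ k, f ℓ ∈ Rsub n δ k ℓ) ∧ S = ∑ ℓ ∈ Finset.range (k + 1), f ℓ := by
  induction k generalizing S with
  | zero =>
    refine ⟨fun _ => S, fun ℓ hℓ => ?_, by simp⟩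
    obtain rfl : ℓ = 0 := by omega
    exact mem_Rsub_zero.2 ⟨hS, hS.iAlpha_eq_zero⟩
  | succ k ih =>
    obtain ⟨f, hf, hsum⟩ := ih (fun p hp => hδ p (by push_cast; omega)) hS.iAlpha
    have hr : ∀ ℓ ≤ k, rConst n δ (ℓ + 1) (k - ℓ) ≠ 0 := fun ℓ hℓ => by
      have := weight_add_ne_zero hδ (2*(k - ℓ) + ℓ) (by omega)
      rw [rConst]
      refine mul_ne_zero (neg_ne_zero.2 (by positivity)) ?_
      push_cast at this ⊢
      convert this using 1
      ring
    set g : ℕ → (Vc n → Vc n → ℝ) := fun ℓ =>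
      (rConst n δ (ℓ + 1) (k - ℓ))⁻¹ • genHam n (2*((n : ℝ)+1)*δ + k) (f ℓ) with hg
    have hgmem : ∀ ℓ ≤ k, g ℓ ∈ Rsub n δ (k + 1) (ℓ + 1) := fun ℓ hℓ =>
      smul_mem_Rsub _ (by omega) ((mem_Rsub_succ hℓ).2 ⟨f ℓ, hf ℓ hℓ, rfl⟩)
    have hgi : ∀ ℓ ≤ k, iAlpha n (g ℓ) = f ℓ := fun ℓ hℓ => by
      rw [hg, iAlpha_smul _ ((InR_of_mem_Rsub hℓ (hf ℓ hℓ)).smooth.genHam _),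
        iAlpha_genHam_of_mem_Rsub hℓ (hf ℓ hℓ), smul_smul, inv_mul_cancel₀ (hr ℓ hℓ), one_smul]
    have hgR : ∀ ℓ ∈ Finset.range (k + 1), InR n (k + 1) (g ℓ) := fun ℓ hℓ =>
      InR_of_mem_Rsub (by simp at hℓ; omega) (hgmem ℓ (by simp at hℓ; omega))
    have hsumR : InR n (k + 1) (∑ ℓ ∈ Finset.range (k + 1), g ℓ) :=
      (symbolModule n (k + 1)).sum_mem hgR
    refine ⟨fun | 0 => S - ∑ ℓ ∈ Finset.range (k + 1), g ℓ | ℓ + 1 => g ℓ, ?_, ?_⟩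
    · rintro (_ | ℓ) hℓ
      · refine mem_Rsub_zero.2 ⟨(symbolModule n (k + 1)).sub_mem hS hsumR, ?_⟩
        have h := iAlpha_add hS.smooth (hsumR.smooth.const_smul (-1))
        rw [iAlpha_smul _ hsumR.smooth, iAlpha_sum _ _ hgR] at h
        rw [sub_eq_add_neg, ← neg_one_smul ℝ, h, hsum, neg_one_smul, ← sub_eq_add_neg,
          sub_eq_zero]
        exact Finset.sum_congr rfl fun ℓ hℓ => (hgi ℓ (by simp at hℓ; omega)).symm
      · exact hgmem ℓ (by omega)
    · rw [Finset.sum_range_succ']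
      simp

lemma casOp_of_mem_Rsub (hℓ : ℓ ≤ k) (hT : T ∈ Rsub n δ k ℓ) :
    casOp n k δ T = epsVal n k δ ℓ • T := by
  funext x ξ
  rw [casOp, genHam_iAlpha_of_mem_Rsub hℓ hT]
  simp only [Pi.smul_apply, smul_eq_mul, epsVal]
  ring

lemma epsVal_ne
    (hδ : ∀ p : ℕ, (p : ℤ) ≤ 2*(k : ℤ) - 2 → δ ≠ -(p : ℝ)/(2*((n : ℝ)+1)))
    {ℓ₁ ℓ₂ : ℕ} (h₁ : ℓ₁ ≤ k) (h₂ : ℓ₂ ≤ k) (hne : ℓ₁ ≠ ℓ₂) :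
    epsVal n k δ ℓ₁ ≠ epsVal n k δ ℓ₂ := by
  intro h
  have hn : (1 / ((n : ℝ) + 2)) ≠ 0 := by positivity
  have h' := add_left_cancel (mul_left_cancel₀ hn h)
  simp only [rConst] at h'
  push_cast [h₁, h₂] at h'
  have hw := weight_add_ne_zero hδ (2*k - 1 - (ℓ₁ + ℓ₂)) (by omega)
  rw [Nat.cast_sub (by omega), Nat.cast_sub (by omega)] at hw
  push_cast at hw
  refine mul_ne_zero (sub_ne_zero.2 (Nat.cast_injective.ne hne : (ℓ₁ : ℝ) ≠ ℓ₂)) hw ?_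
  linear_combination (-2) * h'

variable (n) in
/-- The space of smooth symbols, as a submodule. -/
def smoothModule : Submodule ℝ (Vc n → Vc n → ℝ) where
  carrier := {S | SmoothSymbol n S}
  add_mem' hS hT := hS.add hT
  zero_mem' := SmoothSymbol.zero
  smul_mem' a _ hS := hS.const_smul a

variable (n k δ) in
/-- The Casimir operator as an endomorphism of the space of smooth symbols. -/
def casimirEnd : Module.End ℝ (smoothModule n) where
  toFun S := ⟨casOp n k δ S, (((S.2 : SmoothSymbol n S).const_smul _).add
    (SmoothSymbol.genHam (SmoothSymbol.iAlpha S.2) _)).const_smul _⟩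
  map_add' S T := by
    have hS : SmoothSymbol n S := S.2
    have hT : SmoothSymbol n T := T.2
    ext x ξ
    simp only [casOp, Submodule.coe_add, iAlpha_add hS hT, genHam_add _ hS.iAlpha hT.iAlpha,
      Pi.add_apply]
    ring
  map_smul' c S := by
    have hS : SmoothSymbol n S := S.2
    ext x ξ
    simp only [casOp, Submodule.coe_smul, iAlpha_smul c hS, genHam_smul _ c hS.iAlpha,
      Pi.smul_apply, smul_eq_mul, RingHom.id_apply]
    ring

lemma decomposition_unique
    (hδ : ∀ p : ℕ, (p : ℤ) ≤ 2*(k : ℤ) - 2 → δ ≠ -(p : ℝ)/(2*((n : ℝ)+1)))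
    {f g : Fin (k+1) → (Vc n → Vc n → ℝ)} (hf : ∀ ℓ, f ℓ ∈ Rsub n δ k ℓ.1)
    (hg : ∀ ℓ, g ℓ ∈ Rsub n δ k ℓ.1) (h : ∑ ℓ, f ℓ = ∑ ℓ, g ℓ) : f = g := by
  have hinj : Function.Injective fun ℓ : Fin (k+1) => epsVal n k δ ℓ.1 := fun a b hab => by
    by_contra hne
    exact epsVal_ne hδ (by omega) (by omega) (fun e => hne (Fin.ext e)) hab
  have hind := (casimirEnd n k δ).eigenspaces_iSupIndep.comp hinj
  rw [iSupIndep_iff_finsetSum_eq_imp_eq] at hind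
  have hsm : ∀ ℓ : Fin (k+1), ∀ T ∈ Rsub n δ k ℓ.1, T ∈ smoothModule n := fun ℓ T hT =>
    (InR_of_mem_Rsub (by omega) hT).smooth
  have heig : ∀ ℓ : Fin (k+1), ∀ T (hT : T ∈ Rsub n δ k ℓ.1),
      (⟨T, hsm ℓ T hT⟩ : smoothModule n) ∈
        (casimirEnd n k δ).eigenspace (epsVal n k δ ℓ.1) := fun ℓ T hT =>
    Module.End.mem_eigenspace_iff.2 (Subtype.ext (casOp_of_mem_Rsub (by omega) hT))
  funext ℓ
  have := hind Finset.univ (fun ℓ => ⟨f ℓ, hsm ℓ _ (hf ℓ)⟩) (fun ℓ => ⟨g ℓ, hsm ℓ _ (hg ℓ)⟩)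
    (fun ℓ _ => ⟨heig ℓ _ (hf ℓ), heig ℓ _ (hg ℓ)⟩)
    (Subtype.ext (by simpa using h)) ℓ (Finset.mem_univ ℓ)
  exact congrArg Subtype.val this

end Decomposition

/-- If `δ ∉ 𝒞_k`, `R^k_δ` is the direct sum of the subspaces `R^{k,ℓ}_δ`, each an
eigenspace of the Casimir operator with eigenvalue `ε^{k,ℓ}_δ`, and the eigenvalues
corresponding to distinct `ℓ` are pairwise distinct. -/
theorem stmt11 (n : ℕ) (hn : 1 ≤ n) (k : ℕ) (δ : ℝ)
    (hδ : ∀ p : ℕ, (p : ℤ) ≤ 2*(k : ℤ) - 2 → δ ≠ -(p : ℝ)/(2*((n : ℝ)+1))) :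
    (∀ S, InR n k S → ∃! f : Fin (k+1) → (Vc n → Vc n → ℝ),
      (∀ ℓ : Fin (k+1), f ℓ ∈ Rsub n δ k ℓ.1) ∧
      (∀ x ξ, S x ξ = ∑ ℓ : Fin (k+1), f ℓ x ξ)) ∧
    (∀ ℓ : ℕ, ℓ ≤ k → ∀ T ∈ Rsub n δ k ℓ, ∀ x ξ,
      casOp n k δ T x ξ = epsVal n k δ ℓ * T x ξ) ∧
    (∀ ℓ₁ ℓ₂ : ℕ, ℓ₁ ≤ k → ℓ₂ ≤ k → ℓ₁ ≠ ℓ₂ → epsVal n k δ ℓ₁ ≠ epsVal n k δ ℓ₂) := by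
  refine ⟨fun S hS => ?_, fun ℓ hℓ T hT x ξ => ?_, fun ℓ₁ ℓ₂ h₁ h₂ hne => epsVal_ne hδ h₁ h₂ hne⟩
  · obtain ⟨f, hf, hsum⟩ := exists_decomposition hδ hS
    have hS' : S = ∑ ℓ : Fin (k+1), f ℓ.1 := by
      rw [hsum, Finset.sum_range]
    refine ⟨fun ℓ => f ℓ.1, ⟨fun ℓ => hf ℓ.1 (by omega), fun x ξ => ?_⟩, ?_⟩
    · rw [hS']
      simp [Finset.sum_apply]
    · rintro g ⟨hg, hgsum⟩
      refine decomposition_unique hδ hg (fun ℓ => hf ℓ.1 (by omega)) ?_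
      rw [← hS']
      funext x ξ
      simp [hgsum, Finset.sum_apply]
  · rw [casOp_of_mem_Rsub hℓ hT]
    rfl
end
end

section
/- Let n ≥ 1, k, k' ∈ ℕ, δ, δ' ∈ ℝ, and suppose the Casimir-eigenvalue equalities ε^{k,ℓ_i}_δ = ε^{k',ℓ'_i}_{δ'} hold for three pairs (ℓ_i, ℓ'_i), i = 1,2,3, with ℓ_i ∈ {0,…,k}, ℓ'_i ∈ {0,…,k'}. Set Δ_j = ℓ_1 − ℓ_j, Δ'_j = ℓ'_1 − ℓ'_j, Σ_j = ℓ_1 + ℓ_j, Σ'_j = ℓ'_1 + ℓ'_j for j = 2,3. If the vectors (Δ_2, Δ'_2) and (Δ_3, Δ'_3) are linearly independent, then δ = −(2k−1)/(2(n+1)) + L, where L = (Δ_2Δ'_3Σ_2 − Δ_3Δ'_2Σ_3 + Δ'_2Δ'_3(Σ'_3 − Σ'_2))/(2(n+1)(Δ_2Δ'_3 − Δ_3Δ'_2)); in particular δ is a rational number. -/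
noncomputable section

theorem epsVal_eq_iff {n k k' ℓ ℓ' : ℕ} {δ δ' : ℝ} (h : ℓ ≤ k) (h' : ℓ' ≤ k') :
    epsVal n k δ ℓ = epsVal n k' δ' ℓ' ↔
      cConst n k δ - (ℓ:ℝ) / 2 * (2*((n:ℝ)+1)*δ + 2*(k:ℝ) - 1 - ℓ)
        = cConst n k' δ' - (ℓ':ℝ) / 2 * (2*((n:ℝ)+1)*δ' + 2*(k':ℝ) - 1 - ℓ') := by
  have hn : (1 / ((n:ℝ) + 2)) ≠ 0 := by positivity
  rw [epsVal, epsVal, mul_right_inj' hn, rConst, rConst, Nat.cast_sub h, Nat.cast_sub h']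
  ring_nf

/-- If the Casimir-eigenvalue equalities hold for three pairs `(ℓ_i, ℓ'_i)` with
`(Δ_2,Δ'_2)` and `(Δ_3,Δ'_3)` linearly independent, then
`δ = −(2k−1)/(2(n+1)) + L ∈ ℚ`. -/
theorem stmt18 (n : ℕ) (hn : 1 ≤ n) (k k' : ℕ) (δ δ' : ℝ)
    (ℓ₁ ℓ₂ ℓ₃ ℓ'₁ ℓ'₂ ℓ'₃ : ℕ)
    (h₁ : ℓ₁ ≤ k) (h₂ : ℓ₂ ≤ k) (h₃ : ℓ₃ ≤ k)
    (h'₁ : ℓ'₁ ≤ k') (h'₂ : ℓ'₂ ≤ k') (h'₃ : ℓ'₃ ≤ k')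
    (he₁ : epsVal n k δ ℓ₁ = epsVal n k' δ' ℓ'₁)
    (he₂ : epsVal n k δ ℓ₂ = epsVal n k' δ' ℓ'₂)
    (he₃ : epsVal n k δ ℓ₃ = epsVal n k' δ' ℓ'₃)
    (hind : ((ℓ₁:ℝ) - (ℓ₂:ℝ)) * ((ℓ'₁:ℝ) - (ℓ'₃:ℝ))
        - ((ℓ₁:ℝ) - (ℓ₃:ℝ)) * ((ℓ'₁:ℝ) - (ℓ'₂:ℝ)) ≠ 0) :
    δ = -(2*(k:ℝ) - 1)/(2*((n:ℝ)+1))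
        + (((ℓ₁:ℝ) - (ℓ₂:ℝ)) * ((ℓ'₁:ℝ) - (ℓ'₃:ℝ)) * ((ℓ₁:ℝ) + (ℓ₂:ℝ))
            - ((ℓ₁:ℝ) - (ℓ₃:ℝ)) * ((ℓ'₁:ℝ) - (ℓ'₂:ℝ)) * ((ℓ₁:ℝ) + (ℓ₃:ℝ))
            + ((ℓ'₁:ℝ) - (ℓ'₂:ℝ)) * ((ℓ'₁:ℝ) - (ℓ'₃:ℝ))
                * (((ℓ'₁:ℝ) + (ℓ'₃:ℝ)) - ((ℓ'₁:ℝ) + (ℓ'₂:ℝ))))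
          / (2*((n:ℝ)+1) * (((ℓ₁:ℝ) - (ℓ₂:ℝ)) * ((ℓ'₁:ℝ) - (ℓ'₃:ℝ))
              - ((ℓ₁:ℝ) - (ℓ₃:ℝ)) * ((ℓ'₁:ℝ) - (ℓ'₂:ℝ))))
      ∧ ∃ q : ℚ, δ = (q : ℝ) := by
  rw [epsVal_eq_iff h₁ h'₁] at he₁
  rw [epsVal_eq_iff h₂ h'₂] at he₂
  rw [epsVal_eq_iff h₃ h'₃] at he₃
  have hn1 : (n:ℝ) + 1 ≠ 0 := by positivity
  refine (and_iff_left_of_imp fun hδ => ?_).2 ?_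
  · refine ⟨-(2*(k:ℚ) - 1)/(2*((n:ℚ)+1))
        + (((ℓ₁:ℚ) - ℓ₂) * ((ℓ'₁:ℚ) - ℓ'₃) * ((ℓ₁:ℚ) + ℓ₂)
            - ((ℓ₁:ℚ) - ℓ₃) * ((ℓ'₁:ℚ) - ℓ'₂) * ((ℓ₁:ℚ) + ℓ₃)
            + ((ℓ'₁:ℚ) - ℓ'₂) * ((ℓ'₁:ℚ) - ℓ'₃) * (((ℓ'₁:ℚ) + ℓ'₃) - ((ℓ'₁:ℚ) + ℓ'₂)))
          / (2*((n:ℚ)+1) * (((ℓ₁:ℚ) - ℓ₂) * ((ℓ'₁:ℚ) - ℓ'₃)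
              - ((ℓ₁:ℚ) - ℓ₃) * ((ℓ'₁:ℚ) - ℓ'₂))), ?_⟩
    rw [hδ]
    push_cast
    rfl
  · rw [div_add_div _ _ (by positivity) (mul_ne_zero (by positivity) hind),
      eq_div_iff (mul_ne_zero (by positivity) (mul_ne_zero (by positivity) hind))]
    linear_combination (4 * ((n:ℝ) + 1)) *
      (((ℓ'₁:ℝ) - ℓ'₂) * (he₁ - he₃) - ((ℓ'₁:ℝ) - ℓ'₃) * (he₁ - he₂))
end
end
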